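/- For every real k with 0 ≤ k < 1, if M is the common limit of the AGM sequences started from (1, √(1 − k²)), then K(k) = (π/2)/M. -/

import Mathlib

open Real Filter Topology

/-- The AGM iteration: `agmSeq a b i = (uᵢ, vᵢ)` with `u₀ = a`, `v₀ = b`,
`u_{i+1} = (uᵢ+vᵢ)/2`, `v_{i+1} = √(uᵢ vᵢ)`. -/
noncomputable def agmSeq (a b : ℝ) : ℕ → ℝ × ℝ
  | 0 => (a, b)
  | i + 1 => (((agmSeq a b i).1 + (agmSeq a b i).2) / 2,
      Real.sqrt ((agmSeq a b i).1 * (agmSeq a b i).2))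

/-- The complete elliptic integral of the first kind. -/
noncomputable def K (k : ℝ) : ℝ :=
  ∫ u in (0:ℝ)..(π/2), (1 - k^2 * Real.sin u ^ 2) ^ (-(1/2) : ℝ)

/-- The ratio of double factorials (2j-1)!!/(2j)!!. -/
noncomputable def dfr (j : ℕ) : ℝ :=
  (Nat.doubleFactorial (2*j - 1) : ℝ) / (Nat.doubleFactorial (2*j) : ℝ)

/-- Gauss's form `∫₀^{π/2} dφ / √(a² cos² φ + b² sin² φ)` of the complete elliptic integral. -/
noncomputable def gaussIntegral (a b : ℝ) : ℝ :=
  ∫ x in (0:ℝ)..(π/2), (√(a^2 * cos x ^ 2 + b^2 * sin x ^ 2))⁻¹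

theorem gauss_form_pos {a b : ℝ} (ha : 0 < a) (hb : 0 < b) (x : ℝ) :
    0 < a * cos x ^ 2 + b * sin x ^ 2 := by
  rcases le_total a b with h | h <;>
    nlinarith [sin_sq_add_cos_sq x, sq_nonneg (sin x), sq_nonneg (cos x)]

theorem continuous_gauss_integrand {a b : ℝ} (ha : 0 < a) (hb : 0 < b) :
    Continuous fun x : ℝ => (√(a^2 * cos x ^ 2 + b^2 * sin x ^ 2))⁻¹ :=
  Continuous.inv₀ (by fun_prop) fun x =>
    (sqrt_pos.2 (gauss_form_pos (pow_pos ha 2) (pow_pos hb 2) x)).ne'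

/-- The angle `φ₁` with `tan (φ₁ - φ) = (b / a) tan φ`, written so that it is smooth in `φ`. -/
noncomputable def landenAngle (a b x : ℝ) : ℝ :=
  2 * x - arctan ((a - b) * (sin x * cos x) / (a * cos x ^ 2 + b * sin x ^ 2))

theorem one_add_landen_sq {a b : ℝ} (ha : 0 < a) (hb : 0 < b) (x : ℝ) :
    1 + ((a - b) * (sin x * cos x) / (a * cos x ^ 2 + b * sin x ^ 2)) ^ 2 =
      (a^2 * cos x ^ 2 + b^2 * sin x ^ 2) / (a * cos x ^ 2 + b * sin x ^ 2) ^ 2 := by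
  have hE := (gauss_form_pos ha hb x).ne'
  field_simp
  linear_combination (a^2 * cos x ^ 2 + b^2 * sin x ^ 2) * sin_sq_add_cos_sq x

theorem hasDerivAt_landenAngle {a b : ℝ} (ha : 0 < a) (hb : 0 < b) (x : ℝ) :
    HasDerivAt (landenAngle a b)
      ((a + b) * (a * cos x ^ 2 + b * sin x ^ 2) / (a^2 * cos x ^ 2 + b^2 * sin x ^ 2)) x := by
  have hE := (gauss_form_pos ha hb x).ne'
  have hD := (gauss_form_pos (pow_pos ha 2) (pow_pos hb 2) x).ne'
  have hnum := ((hasDerivAt_sin x).mul (hasDerivAt_cos x)).const_mul (a - b)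
  have hden := (((hasDerivAt_cos x).pow 2).const_mul a).add (((hasDerivAt_sin x).pow 2).const_mul b)
  have h := ((hasDerivAt_id x).const_mul 2).sub (hnum.div hden hE).arctan
  refine h.congr_deriv ?_
  simp only [Pi.mul_apply, Pi.add_apply, Pi.pow_apply, Pi.div_apply]
  rw [one_add_landen_sq ha hb x]
  have hs := sin_sq_add_cos_sq x
  field_simp
  simp only [Nat.cast_ofNat, Nat.add_one_sub_one, pow_one]
  have hc : cos x ^ 2 = 1 - sin x ^ 2 := by linarith
  have hc4 : cos x ^ 4 = (1 - sin x ^ 2) ^ 2 := by rw [← hc]; ring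
  ring_nf
  simp only [hc, hc4]
  ring

theorem gauss_form_landenAngle {a b : ℝ} (ha : 0 < a) (hb : 0 < b) (x : ℝ) :
    ((a + b) / 2) ^ 2 * cos (landenAngle a b x) ^ 2 + √(a * b) ^ 2 * sin (landenAngle a b x) ^ 2 =
      ((a + b) / 2 * (a * cos x ^ 2 + b * sin x ^ 2)) ^ 2 /
        (a^2 * cos x ^ 2 + b^2 * sin x ^ 2) := by
  have hroot := congrArg sqrt (one_add_landen_sq ha hb x)
  have hE := gauss_form_pos ha hb x
  have hD := gauss_form_pos (pow_pos ha 2) (pow_pos hb 2) x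
  rw [sqrt_div hD.le, sqrt_sq hE.le] at hroot
  have hR := (sqrt_pos.2 hD).ne'
  have hR2 := sq_sqrt hD.le
  have hs := sin_sq_add_cos_sq x
  have hcos : cos (landenAngle a b x) =
      (a * cos x ^ 2 - b * sin x ^ 2) / √(a^2 * cos x ^ 2 + b^2 * sin x ^ 2) := by
    rw [landenAngle, cos_sub, cos_arctan, sin_arctan, hroot, cos_two_mul, sin_two_mul]
    generalize √(a^2 * cos x ^ 2 + b^2 * sin x ^ 2) = R at hR
    generalize hEq : a * cos x ^ 2 + b * sin x ^ 2 = E at hE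
    field_simp
    rw [← hEq]
    linear_combination 2 * a * cos x ^ 2 * hs
  have hsin : sin (landenAngle a b x) =
      (a + b) * (sin x * cos x) / √(a^2 * cos x ^ 2 + b^2 * sin x ^ 2) := by
    rw [landenAngle, sin_sub, cos_arctan, sin_arctan, hroot, cos_two_mul, sin_two_mul]
    generalize √(a^2 * cos x ^ 2 + b^2 * sin x ^ 2) = R at hR
    generalize hEq : a * cos x ^ 2 + b * sin x ^ 2 = E at hE
    field_simp
    rw [← hEq]
    linear_combination 2 * b * sin x * cos x * hs
  rw [hcos, hsin, sq_sqrt (mul_pos ha hb).le]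
  simp only [div_pow, hR2]
  generalize a^2 * cos x ^ 2 + b^2 * sin x ^ 2 = D at hD
  field_simp
  ring

theorem integral_gauss_zero_pi {a b : ℝ} (ha : 0 < a) (hb : 0 < b) :
    ∫ x in (0:ℝ)..π, (√(a^2 * cos x ^ 2 + b^2 * sin x ^ 2))⁻¹ = 2 * gaussIntegral a b := by
  have hc := continuous_gauss_integrand ha hb
  have hsymm : ∫ x in (π/2)..π, (√(a^2 * cos x ^ 2 + b^2 * sin x ^ 2))⁻¹ = gaussIntegral a b := by
    have h := intervalIntegral.integral_comp_sub_left (a := 0) (b := π/2)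
      (fun x => (√(a^2 * cos x ^ 2 + b^2 * sin x ^ 2))⁻¹) π
    simp only [cos_pi_sub, sin_pi_sub, neg_sq, sub_zero] at h
    rw [show π - π/2 = π/2 by ring] at h
    exact h.symm
  rw [← intervalIntegral.integral_add_adjacent_intervals (hc.intervalIntegrable 0 (π/2))
    (hc.intervalIntegrable (π/2) π), hsymm, gaussIntegral]
  ring

theorem gaussIntegral_agm_step {a b : ℝ} (ha : 0 < a) (hb : 0 < b) :
    gaussIntegral ((a + b) / 2) √(a * b) = gaussIntegral a b := by
  have hE := gauss_form_pos ha hb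
  have hD := gauss_form_pos (pow_pos ha 2) (pow_pos hb 2)
  have hsub := intervalIntegral.integral_comp_mul_deriv (a := 0) (b := π/2)
    (fun x _ => hasDerivAt_landenAngle ha hb x)
    (Continuous.continuousOn (Continuous.div (by fun_prop) (by fun_prop) fun x => (hD x).ne'))
    (continuous_gauss_integrand (half_pos (add_pos ha hb)) (sqrt_pos.2 (mul_pos ha hb)))
  have h0 : landenAngle a b 0 = 0 := by simp [landenAngle]
  have h1 : landenAngle a b (π/2) = π := by simp [landenAngle]; ring
  rw [h0, h1, integral_gauss_zero_pi (half_pos (add_pos ha hb)) (sqrt_pos.2 (mul_pos ha hb))]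
    at hsub
  have hint : ∀ x, ((fun y => (√(((a + b) / 2) ^ 2 * cos y ^ 2 + √(a * b) ^ 2 * sin y ^ 2))⁻¹) ∘
      landenAngle a b) x *
        ((a + b) * (a * cos x ^ 2 + b * sin x ^ 2) / (a^2 * cos x ^ 2 + b^2 * sin x ^ 2)) =
      2 * (√(a^2 * cos x ^ 2 + b^2 * sin x ^ 2))⁻¹ := fun x => by
    have hEx := hE x
    have hR := sqrt_pos.2 (hD x)
    have hR2 := sq_sqrt (hD x).le
    rw [Function.comp_apply, gauss_form_landenAngle ha hb x, sqrt_div (sq_nonneg _),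
      sqrt_sq (mul_pos (half_pos (add_pos ha hb)) hEx).le]
    generalize √(a^2 * cos x ^ 2 + b^2 * sin x ^ 2) = R at hR hR2 ⊢
    rw [← hR2]
    field_simp
  simp only [hint, intervalIntegral.integral_const_mul] at hsub
  unfold gaussIntegral at hsub ⊢
  linarith

theorem gaussIntegral_bounds {a b : ℝ} (hb : 0 < b) (hba : b ≤ a) :
    π/2 / a ≤ gaussIntegral a b ∧ gaussIntegral a b ≤ π/2 / b := by
  have ha := hb.trans_le hba
  have hsq : b^2 ≤ a^2 := pow_le_pow_left₀ hb.le hba 2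
  have hc := continuous_gauss_integrand ha hb
  have hform := gauss_form_pos (pow_pos ha 2) (pow_pos hb 2)
  have hconst : ∀ c : ℝ, ∫ _ in (0:ℝ)..(π/2), c⁻¹ = π/2 / c := fun c => by
    simp [div_eq_mul_inv]
  rw [← hconst a, ← hconst b]
  constructor
  · refine intervalIntegral.integral_mono_on pi_div_two_pos.le (by simp) (hc.intervalIntegrable _ _)
      fun x _ => inv_anti₀ (sqrt_pos.2 (hform x)) (sqrt_le_iff.2 ⟨ha.le, ?_⟩)
    nlinarith [sin_sq_add_cos_sq x, sq_nonneg (sin x)]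
  · refine intervalIntegral.integral_mono_on pi_div_two_pos.le (hc.intervalIntegrable _ _) (by simp)
      fun x _ => inv_anti₀ hb (le_sqrt_of_sq_le ?_)
    nlinarith [sin_sq_add_cos_sq x, sq_nonneg (cos x)]

theorem agmSeq_bounds {a b : ℝ} (hb : 0 < b) (hba : b ≤ a) (n : ℕ) :
    b ≤ (agmSeq a b n).2 ∧ (agmSeq a b n).2 ≤ (agmSeq a b n).1 := by
  induction n with
  | zero => exact ⟨le_rfl, hba⟩
  | succ n ih =>
    obtain ⟨h1, h2⟩ := ih
    simp only [agmSeq]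
    exact ⟨le_sqrt_of_sq_le (by nlinarith),
      sqrt_le_iff.2 ⟨by linarith, by nlinarith [sq_nonneg ((agmSeq a b n).1 - (agmSeq a b n).2)]⟩⟩

theorem gaussIntegral_agmSeq {a b : ℝ} (hb : 0 < b) (hba : b ≤ a) (n : ℕ) :
    gaussIntegral (agmSeq a b n).1 (agmSeq a b n).2 = gaussIntegral a b := by
  induction n with
  | zero => rfl
  | succ n ih =>
    obtain ⟨h1, h2⟩ := agmSeq_bounds hb hba n
    have hv := hb.trans_le h1
    rw [← ih, ← gaussIntegral_agm_step (hv.trans_le h2) hv]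
    rfl

theorem gaussIntegral_eq_of_tendsto_agmSeq {a b M : ℝ} (hb : 0 < b) (hba : b ≤ a)
    (hu : Tendsto (fun i => (agmSeq a b i).1) atTop (𝓝 M))
    (hv : Tendsto (fun i => (agmSeq a b i).2) atTop (𝓝 M)) :
    gaussIntegral a b = π/2 / M := by
  have hM : 0 < M := hb.trans_le (ge_of_tendsto' hv fun n => (agmSeq_bounds hb hba n).1)
  have hbd : ∀ n, π/2 / (agmSeq a b n).1 ≤ gaussIntegral a b ∧
      gaussIntegral a b ≤ π/2 / (agmSeq a b n).2 := fun n => by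
    obtain ⟨h1, h2⟩ := agmSeq_bounds hb hba n
    rw [← gaussIntegral_agmSeq hb hba n]
    exact gaussIntegral_bounds (hb.trans_le h1) h2
  exact le_antisymm
    (ge_of_tendsto' (tendsto_const_nhds.div hv hM.ne') fun n => (hbd n).2)
    (le_of_tendsto' (tendsto_const_nhds.div hu hM.ne') fun n => (hbd n).1)

theorem K_eq_gaussIntegral {k : ℝ} (hk0 : 0 ≤ k) (hk1 : k < 1) :
    K k = gaussIntegral 1 √(1 - k^2) := by
  have hk : 0 < 1 - k^2 := by nlinarith
  refine intervalIntegral.integral_congr fun x _ => ?_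
  have heq : 1 - k^2 * sin x ^ 2 = 1^2 * cos x ^ 2 + √(1 - k^2) ^ 2 * sin x ^ 2 := by
    rw [sq_sqrt hk.le]
    linear_combination -sin_sq_add_cos_sq x
  have hpos := gauss_form_pos (pow_pos one_pos 2) (pow_pos (sqrt_pos.2 hk) 2) x
  simp only [heq]
  rw [rpow_neg hpos.le, ← sqrt_eq_rpow]

theorem cei1_agm_king (k : ℝ) (hk0 : 0 ≤ k) (hk1 : k < 1) (M : ℝ)
    (hu : Tendsto (fun i => (agmSeq 1 (Real.sqrt (1 - k^2)) i).1) atTop (𝓝 M))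
    (hv : Tendsto (fun i => (agmSeq 1 (Real.sqrt (1 - k^2)) i).2) atTop (𝓝 M)) :
    K k = (π/2) / M := by
  have hk : 0 < 1 - k^2 := by nlinarith
  rw [K_eq_gaussIntegral hk0 hk1]
  exact gaussIntegral_eq_of_tendsto_agmSeq (sqrt_pos.2 hk)
    (sqrt_le_one.2 (by nlinarith)) hu hv
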